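/- arXiv:1710.09795 — 2 statements merged into one kernel-verified Lean document; each statement's English description precedes it below -/
import Mathlib

section
/- Fix a finite alphabet Σ and a symbol ⊥ ∉ Σ. For a string P over Σ and integer k ≥ 1, let suf_k(P) denote the last k symbols of P if k ≤ |P|, and the string ⊥^{k-|P|}·P otherwise. For strings S, S' over Σ define the relative suffix distance RSD(S,S') = sup over k ≥ 1 of ED(suf_k(S), suf_k(S'))/(2k). Then for all strings S₁, S₂, S₃ over Σ: (i) symmetry: RSD(S₁,S₂) = RSD(S₂,S₁); (ii) non-negativity and normalization: 0 ≤ RSD(S₁,S₂) ≤ 1; (iii) identity of indiscernibles: RSD(S₁,S₂) = 0 if and only if S₁ = S₂; and (iv) triangle inequality: RSD(S₁,S₃) ≤ RSD(S₁,S₂) + RSD(S₂,S₃). In particular, RSD defines a metric on any set of strings over Σ. -/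
/-- Length of a longest common subsequence of `a` and `b`. -/
def lcsLen {α : Type*} [DecidableEq α] (a b : List α) : ℕ :=
  ((a.sublists.filter (fun c => decide (c.Sublist b))).map List.length).foldr max 0

/-- Edit distance: the minimum number of single-symbol insertions and deletions
transforming one string into the other, via `ED a b = |a| + |b| - 2·LCS(a,b)`. -/
def ED {α : Type*} [DecidableEq α] (a b : List α) : ℕ :=
  a.length + b.length - 2 * lcsLen a b

/-- `substr S i j` is the substring `S[i,j)` from 1-based position `i` (inclusive)
to position `j` (exclusive). -/
def substr {α : Type*} (S : List α) (i j : ℕ) : List α :=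
  (S.drop (i - 1)).take (j - i)


/-- `suf k P` is the suffix of `P` of length `k`, padded on the left with the
symbol `⊥ = none` (not in the alphabet) if `k > |P|`. -/
def suf {α : Type*} (k : ℕ) (P : List α) : List (Option α) :=
  List.replicate (k - P.length) none ++ (P.map some).drop (P.length - k)


/-- The relative suffix distance `RSD(S,S') = sup_{k ≥ 1} ED(suf_k S, suf_k S')/(2k)`. -/
noncomputable def RSD {α : Type*} [DecidableEq α] (S S' : List α) : ℝ :=
  ⨆ k : ℕ+, (ED (suf k S) (suf k S') : ℝ) / (2 * k)

theorem le_foldr_max {l : List ℕ} {n : ℕ} (h : n ∈ l) : n ≤ l.foldr max 0 := by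
  induction l with
  | nil => simp at h
  | cons x l ih =>
    rcases List.mem_cons.1 h with rfl | h
    · simp
    · exact (ih h).trans (by simp)

theorem foldr_max_mem {l : List ℕ} (h : l ≠ []) : l.foldr max 0 ∈ l := by
  induction l with
  | nil => exact absurd rfl h
  | cons x l ih =>
    rcases eq_or_ne l [] with rfl | hl
    · simp
    · rcases max_choice x (l.foldr max 0) with h' | h'
      · simp [h']
      · simp only [List.foldr_cons, h']
        exact List.mem_cons_of_mem _ (ih hl)

/-- Two subsequences `c`, `d` of `b` share a subsequence of length at least `|c| + |d| - |b|`. -/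
theorem exists_common_sublist {α : Type*} {b c d : List α} (hc : c.Sublist b) (hd : d.Sublist b) :
    ∃ e : List α, e.Sublist c ∧ e.Sublist d ∧ c.length + d.length ≤ b.length + e.length := by
  induction b generalizing c d with
  | nil =>
    obtain rfl := List.sublist_nil.1 hc
    exact ⟨[], by simp, by simp, by simpa using hd.length_le⟩
  | cons x b ih =>
    cases hc with
    | cons _ hc =>
      cases hd with
      | cons _ hd =>
        obtain ⟨e, h₁, h₂, h⟩ := ih hc hd
        exact ⟨e, h₁, h₂, by simp; omega⟩
      | cons_cons _ hd =>
        obtain ⟨e, h₁, h₂, h⟩ := ih hc hd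
        exact ⟨e, h₁, h₂.cons _, by simp; omega⟩
    | cons_cons _ hc =>
      cases hd with
      | cons _ hd =>
        obtain ⟨e, h₁, h₂, h⟩ := ih hc hd
        exact ⟨e, h₁.cons _, h₂, by simp; omega⟩
      | cons_cons _ hd =>
        obtain ⟨e, h₁, h₂, h⟩ := ih hc hd
        exact ⟨x :: e, h₁.cons_cons _, h₂.cons_cons _, by simp; omega⟩

theorem length_suf {α : Type*} (k : ℕ) (P : List α) : (suf k P).length = k := by
  simp only [suf, List.length_append, List.length_replicate, List.length_drop, List.length_map]
  omega

theorem reduceOption_suf {α : Type*} {k : ℕ} {P : List α} (h : P.length ≤ k) :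
    (suf k P).reduceOption = P := by
  simp [suf, Nat.sub_eq_zero_of_le h, List.reduceOption]

section EditDistance

variable {α : Type*} [DecidableEq α]

theorem length_le_lcsLen {a b c : List α} (ha : c.Sublist a) (hb : c.Sublist b) :
    c.length ≤ lcsLen a b :=
  le_foldr_max (List.mem_map_of_mem (by simp [ha, hb]))

theorem exists_sublist_length_eq_lcsLen (a b : List α) :
    ∃ c : List α, c.Sublist a ∧ c.Sublist b ∧ c.length = lcsLen a b := by
  have hne : (a.sublists.filter (fun c => decide (c.Sublist b))).map List.length ≠ [] := by
    intro h
    have : ([] : List α) ∈ a.sublists.filter (fun c => decide (c.Sublist b)) := by simp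
    rw [List.map_eq_nil_iff.1 h] at this
    simp at this
  obtain ⟨c, hc, hlen⟩ := List.mem_map.1 (foldr_max_mem hne)
  simp only [List.mem_filter, List.mem_sublists, decide_eq_true_eq] at hc
  exact ⟨c, hc.1, hc.2, hlen⟩

theorem lcsLen_comm (a b : List α) : lcsLen a b = lcsLen b a := by
  obtain ⟨c, ha, hb, h⟩ := exists_sublist_length_eq_lcsLen a b
  obtain ⟨d, hb', ha', h'⟩ := exists_sublist_length_eq_lcsLen b a
  exact le_antisymm (h ▸ length_le_lcsLen hb ha) (h' ▸ length_le_lcsLen ha' hb')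

theorem lcsLen_le_left (a b : List α) : lcsLen a b ≤ a.length := by
  obtain ⟨c, ha, -, h⟩ := exists_sublist_length_eq_lcsLen a b
  exact h ▸ ha.length_le

theorem lcsLen_le_right (a b : List α) : lcsLen a b ≤ b.length :=
  lcsLen_comm b a ▸ lcsLen_le_left b a

theorem lcsLen_add_lcsLen_le (a b c : List α) :
    lcsLen a b + lcsLen b c ≤ b.length + lcsLen a c := by
  obtain ⟨d, hda, hdb, hd⟩ := exists_sublist_length_eq_lcsLen a b
  obtain ⟨e, heb, hec, he⟩ := exists_sublist_length_eq_lcsLen b c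
  obtain ⟨f, hfd, hfe, hf⟩ := exists_common_sublist hdb heb
  have := length_le_lcsLen (hfd.trans hda) (hfe.trans hec)
  omega

theorem ED_comm (a b : List α) : ED a b = ED b a := by
  rw [ED, ED, lcsLen_comm, add_comm]

theorem ED_le (a b : List α) : ED a b ≤ a.length + b.length := Nat.sub_le _ _

theorem ED_triangle (a b c : List α) : ED a c ≤ ED a b + ED b c := by
  have := lcsLen_add_lcsLen_le a b c
  have := lcsLen_le_left a b
  have := lcsLen_le_right a b
  have := lcsLen_le_left b c
  have := lcsLen_le_right b c
  unfold ED
  omega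

theorem ED_self (a : List α) : ED a a = 0 := by
  have := length_le_lcsLen (List.Sublist.refl a) (List.Sublist.refl a)
  unfold ED
  omega

theorem eq_of_ED_eq_zero {a b : List α} (h : ED a b = 0) : a = b := by
  obtain ⟨c, hca, hcb, hc⟩ := exists_sublist_length_eq_lcsLen a b
  have := lcsLen_le_left a b
  have := lcsLen_le_right a b
  unfold ED at h
  rw [← hca.eq_of_length (by omega), ← hcb.eq_of_length (by omega)]

theorem ED_suf_div_nonneg (S S' : List α) (k : ℕ+) :
    0 ≤ (ED (suf k S) (suf k S') : ℝ) / (2 * k) := by positivity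

theorem ED_suf_div_le_one (S S' : List α) (k : ℕ+) :
    (ED (suf k S) (suf k S') : ℝ) / (2 * k) ≤ 1 := by
  have h := ED_le (suf k S) (suf k S')
  rw [length_suf, length_suf, ← two_mul] at h
  exact div_le_one_of_le₀ (by exact_mod_cast h) (by positivity)

theorem ED_suf_div_le_RSD (S S' : List α) (k : ℕ+) :
    (ED (suf k S) (suf k S') : ℝ) / (2 * k) ≤ RSD S S' :=
  le_ciSup (f := fun k : ℕ+ => (ED (suf k S) (suf k S') : ℝ) / (2 * k))
    ⟨1, Set.forall_mem_range.2 (ED_suf_div_le_one S S')⟩ k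

theorem eq_of_RSD_eq_zero {S S' : List α} (h : RSD S S' = 0) : S = S' := by
  let k : ℕ+ := ⟨S.length + S'.length + 1, by omega⟩
  have hk : (k : ℕ) = S.length + S'.length + 1 := rfl
  have h₀ := le_antisymm ((ED_suf_div_le_RSD S S' k).trans_eq h) (ED_suf_div_nonneg S S' k)
  have hk' : (2 * (k : ℕ) : ℝ) ≠ 0 := by positivity
  have hED : ED (suf k S) (suf k S') = 0 := by
    exact_mod_cast (div_eq_zero_iff.1 h₀).resolve_right hk'
  rw [← reduceOption_suf (P := S) (k := k) (by omega), eq_of_ED_eq_zero hED,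
    reduceOption_suf (by omega)]

end EditDistance

/-- `RSD` is symmetric, takes values in `[0,1]`, vanishes exactly on equal
strings, and satisfies the triangle inequality; in particular it is a metric on
any set of strings over `Σ`. -/
theorem stmt_12 {α : Type*} [DecidableEq α] (S₁ S₂ S₃ : List α) :
    RSD S₁ S₂ = RSD S₂ S₁ ∧
    (0 ≤ RSD S₁ S₂ ∧ RSD S₁ S₂ ≤ 1) ∧
    (RSD S₁ S₂ = 0 ↔ S₁ = S₂) ∧
    RSD S₁ S₃ ≤ RSD S₁ S₂ + RSD S₂ S₃ := by
  refine ⟨?_, ⟨Real.iSup_nonneg (ED_suf_div_nonneg S₁ S₂), ciSup_le (ED_suf_div_le_one S₁ S₂)⟩,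
    ⟨eq_of_RSD_eq_zero, ?_⟩, ciSup_le fun k => ?_⟩
  · simp only [RSD, ED_comm]
  · rintro rfl
    simp [RSD, ED_self]
  · refine le_trans ?_ (add_le_add (ED_suf_div_le_RSD S₁ S₂ k) (ED_suf_div_le_RSD S₂ S₃ k))
    rw [← add_div]
    gcongr
    exact_mod_cast ED_triangle (suf k S₁) (suf k S₂) (suf k S₃)
end

section
/- For every real c > 1 there exist constants c₀ > 1 and ε₀ > 0 such that for every ε ∈ (0, ε₀) and every positive integer n, there exists an f(l)-distance ε-synchronization string of length n over an alphabet of size at most c₀^{1/ε}, where f(l) = ⌊c^l⌋. -/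
/-- `S` is an `f(l)`-distance `ε`-synchronization string: for all positions
`1 ≤ i < j ≤ i' < j' ≤ |S| + 1` with `i' - j ≤ f(l)` where `l = (j-i)+(j'-i')`,
`ED(S[i,j), S[i',j')) > (1-ε)·l`. -/
def FDistSync {α : Type*} [DecidableEq α] (f : ℕ → ℕ) (ε : ℝ) (S : List α) : Prop :=
  ∀ i j i' j' : ℕ, 1 ≤ i → i < j → j ≤ i' → i' < j' → j' ≤ S.length + 1 →
    i' - j ≤ f ((j - i) + (j' - i')) →
    (ED (substr S i j) (substr S i' j') : ℝ) >
      (1 - ε) * (((j - i) + (j' - i') : ℕ) : ℝ)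

open Finset

theorem exists_common_sublist_length_eq_lcsLen {α : Type*} [DecidableEq α] (a b : List α) :
    ∃ w : List α, w.Sublist a ∧ w.Sublist b ∧ w.length = lcsLen a b := by
  have key : ∀ L : List (List α), (∀ w ∈ L, w.Sublist a ∧ w.Sublist b) →
      ∃ w : List α, w.Sublist a ∧ w.Sublist b ∧ w.length = (L.map List.length).foldr max 0 := by
    intro L
    induction L with
    | nil => exact fun _ => ⟨[], by simp⟩
    | cons x L ih =>
      intro h
      obtain ⟨w, ha, hb, hw⟩ := ih fun w hw => h w (List.mem_cons_of_mem _ hw)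
      have hx := h x List.mem_cons_self
      simp only [List.map_cons, List.foldr_cons]
      rcases le_total x.length ((L.map List.length).foldr max 0) with hle | hle
      · exact ⟨w, ha, hb, by rw [hw, max_eq_right hle]⟩
      · exact ⟨x, hx.1, hx.2, by rw [max_eq_left hle]⟩
  exact key _ fun w hw => by simpa using hw

theorem length_substr {α : Type*} {S : List α} {i j : ℕ} (hi : 1 ≤ i) (hj : j ≤ S.length + 1) :
    (substr S i j).length = j - i := by
  simp only [substr, List.length_take, List.length_drop]
  omega

theorem length_substr_le {α : Type*} (S : List α) (i j : ℕ) :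
    (substr S i j).length ≤ j - i := by
  simp [substr]

theorem substr_append_left {α : Type*} {S T : List α} {i j : ℕ} (hi : 1 ≤ i)
    (hij : i ≤ j) (hj : j ≤ S.length + 1) : substr (S ++ T) i j = substr S i j := by
  simp only [substr]
  rw [List.drop_append_of_le_length (by omega), List.take_append_of_le_length]
  simp only [List.length_drop]
  omega

theorem FDistSync.of_append {α : Type*} [DecidableEq α] {f : ℕ → ℕ} {ε : ℝ} {S T : List α}
    (h : FDistSync f ε (S ++ T)) : FDistSync f ε S := by
  intro i j i' j' hi hij hji hij' hj' hd
  have := h i j i' j' hi hij hji hij' (by simp; omega) hd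
  rwa [substr_append_left hi hij.le (by omega), substr_append_left (by omega) hij'.le hj'] at this

/-- A violation of the synchronization property yields a long common subsequence. -/
theorem exists_common_sublist_of_ED_le {α : Type*} [DecidableEq α] {a b : List α} {ε : ℝ}
    (h : (ED a b : ℝ) ≤ (1 - ε) * ((a.length + b.length : ℕ) : ℝ)) :
    ∃ w : List α, w.Sublist a ∧ w.Sublist b ∧
      ε * ((a.length + b.length : ℕ) : ℝ) ≤ 2 * w.length := by
  obtain ⟨w, ha, hb, hw⟩ := exists_common_sublist_length_eq_lcsLen a b
  refine ⟨w, ha, hb, ?_⟩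
  have h1 : a.length + b.length ≤ ED a b + 2 * w.length := by
    rw [hw]; unfold ED; omega
  have h2 : ((a.length + b.length : ℕ) : ℝ) ≤ ED a b + 2 * w.length := by exact_mod_cast h1
  linarith

/-- The words of length `n` over the alphabet `Fin m`. -/
def words (m n : ℕ) : Finset (List (Fin m)) :=
  (univ : Finset (List.Vector (Fin m) n)).map ⟨List.Vector.toList, Subtype.val_injective⟩

theorem mem_words {m n : ℕ} {w : List (Fin m)} : w ∈ words m n ↔ w.length = n := by
  simp only [words, mem_map, mem_univ, true_and]
  exact ⟨fun ⟨v, hv⟩ => hv ▸ v.toList_length, fun h => ⟨⟨w, h⟩, rfl⟩⟩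

theorem card_words (m n : ℕ) : #(words m n) = m ^ n := by
  simp [words]

/-- Few words of length `L` contain a given word as a subsequence. -/
theorem card_superwords_le {m : ℕ} (hm : 0 < m) (L : ℕ) (w : List (Fin m)) :
    (#{T ∈ words m L | w.Sublist T} : ℝ) ≤ 2 ^ L * m ^ L / m ^ w.length := by
  have hm' : (0 : ℝ) < m := by exact_mod_cast hm
  induction L generalizing w with
  | zero =>
    cases w with
    | nil => simp [card_words]
    | cons y w =>
      rw [filter_eq_empty_iff.2]
      · simp
      · intro T hT hw
        rw [mem_words, List.length_eq_zero_iff] at hT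
        simp [hT] at hw
  | succ L ih =>
    cases w with
    | nil =>
      have h : (#{T ∈ words m (L + 1) | List.Sublist [] T} : ℝ) ≤ m ^ (L + 1) := by
        exact_mod_cast (card_filter_le _ _).trans (card_words m (L + 1)).le
      have h2 : (1 : ℝ) ≤ 2 ^ (L + 1) := one_le_pow₀ (by norm_num)
      have h3 : (0 : ℝ) < m ^ (L + 1) := by positivity
      simp only [List.length_nil, pow_zero, div_one]
      nlinarith
    | cons y w =>
      have hsub : {T ∈ words m (L + 1) | (y :: w).Sublist T} ⊆
          (univ ×ˢ {T ∈ words m L | (y :: w).Sublist T}).image (fun p => p.1 :: p.2) ∪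
            {T ∈ words m L | w.Sublist T}.image (List.cons y) := by
        intro T hT
        obtain ⟨hT, hw⟩ := mem_filter.1 hT
        rw [mem_words] at hT
        cases T with
        | nil => simp at hT
        | cons x T =>
          have hT' : T.length = L := by simpa using hT
          cases hw with
          | cons _ h =>
            exact mem_union_left _ <| mem_image.2
              ⟨(x, T), by simp [mem_words, hT', h], rfl⟩
          | cons_cons _ h =>
            exact mem_union_right _ <| mem_image.2 ⟨T, by simp [mem_words, hT', h], rfl⟩
      have hcard := (card_le_card hsub).trans (card_union_le _ _)
      have h1 := card_image_le (s := univ ×ˢ {T ∈ words m L | (y :: w).Sublist T})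
        (f := fun p : Fin m × List (Fin m) => p.1 :: p.2)
      have h2 := card_image_le (s := {T ∈ words m L | w.Sublist T}) (f := List.cons y)
      rw [card_product, card_univ, Fintype.card_fin] at h1
      have h3 : (#{T ∈ words m (L + 1) | (y :: w).Sublist T} : ℝ) ≤
          m * #{T ∈ words m L | (y :: w).Sublist T} + #{T ∈ words m L | w.Sublist T} := by
        exact_mod_cast hcard.trans (add_le_add h1 h2)
      refine h3.trans ((add_le_add (mul_le_mul_of_nonneg_left (ih (y :: w)) hm'.le)
        (ih w)).trans_eq ?_)
      rw [List.length_cons]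
      field_simp
      ring

theorem cast_card_biUnion_le {ι α : Type*} [DecidableEq α] (s : Finset ι) (t : ι → Finset α)
    {C : ℝ} (h : ∀ i ∈ s, (#(t i) : ℝ) ≤ C) : (#(s.biUnion t) : ℝ) ≤ #s * C := by
  calc (#(s.biUnion t) : ℝ) ≤ ∑ i ∈ s, (#(t i) : ℝ) := by exact_mod_cast card_biUnion_le
    _ ≤ #s * C := by simpa using sum_le_card_nsmul s _ C h

open Classical in
/-- The `f(l)`-distance `ε`-synchronization strings of length `n` over `Fin m`. -/
noncomputable def syncWords (f : ℕ → ℕ) (ε : ℝ) (m n : ℕ) : Finset (List (Fin m)) :=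
  {S ∈ words m n | FDistSync f ε S}

theorem mem_syncWords {f : ℕ → ℕ} {ε : ℝ} {m n : ℕ} {S : List (Fin m)} :
    S ∈ syncWords f ε m n ↔ S.length = n ∧ FDistSync f ε S := by
  simp [syncWords, mem_words]

/-- The subsequences, long relative to `La + Lb`, of the length `La` window that ends `d` symbols
before the end of `P`. -/
noncomputable def longSubwords {m : ℕ} (ε : ℝ) (La Lb d : ℕ) (P : List (Fin m)) :
    Finset (List (Fin m)) :=
  {w ∈ (substr P (P.length + 1 - d - La) (P.length + 1 - d)).sublists.toFinset |
    ε * ((La + Lb : ℕ) : ℝ) ≤ 2 * w.length}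

theorem card_longSubwords_le {m : ℕ} (ε : ℝ) (La Lb d : ℕ) (P : List (Fin m)) :
    (#(longSubwords ε La Lb d P) : ℝ) ≤ 2 ^ La := by
  have h : #(longSubwords ε La Lb d P) ≤ 2 ^ La := by
    refine (card_filter_le _ _).trans ((List.toFinset_card_le _).trans ?_)
    rw [List.length_sublists]
    exact Nat.pow_le_pow_right (by norm_num) ((length_substr_le _ _ _).trans (by omega))
  exact_mod_cast h

/-- The words of length `n + 1` with a synchronization violation whose second window is the final
`Lb` symbols and whose first window has length `La`, and whose prefix before the second window is
a synchronization string. -/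
noncomputable def violators (f : ℕ → ℕ) (ε : ℝ) (m n La Lb : ℕ) : Finset (List (Fin m)) :=
  (range (f (La + Lb) + 1)).biUnion fun d =>
    (syncWords f ε m (n + 1 - Lb)).biUnion fun P =>
      (longSubwords ε La Lb d P).biUnion fun w =>
        {T ∈ words m Lb | w.Sublist T}.image (P ++ ·)

theorem card_violators_le {f : ℕ → ℕ} {ε c M : ℝ} {m : ℕ} (hm : 1 ≤ m) (hc : 1 < c)
    (hM : 0 < M) (hf : ∀ l, (f l : ℝ) ≤ c ^ l) (hmM : M ^ (2 / ε) ≤ m) (hε : 0 < ε)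
    (n La Lb : ℕ) :
    (#(violators f ε m n La Lb) : ℝ) ≤
      2 * c ^ (La + Lb) * (#(syncWords f ε m (n + 1 - Lb)) *
        (2 ^ La * (2 ^ Lb * m ^ Lb / M ^ (La + Lb)))) := by
  have hm' : (1 : ℝ) ≤ m := by exact_mod_cast hm
  refine (cast_card_biUnion_le _ _ (C := #(syncWords f ε m (n + 1 - Lb)) *
        (2 ^ La * (2 ^ Lb * m ^ Lb / M ^ (La + Lb)))) fun d _ => ?_).trans ?_
  · refine cast_card_biUnion_le _ _ fun P _ => ?_
    refine (cast_card_biUnion_le _ _ (C := 2 ^ Lb * m ^ Lb / M ^ (La + Lb))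
      fun w hw => ?_).trans ?_
    · refine (Nat.cast_le.2 card_image_le).trans ((card_superwords_le hm Lb w).trans ?_)
      have hw := (mem_filter.1 hw).2
      gcongr
      calc M ^ (La + Lb) = (M ^ (2 / ε)) ^ (ε * ((La + Lb : ℕ) : ℝ) / 2) := by
            rw [← Real.rpow_mul hM.le, ← Real.rpow_natCast]
            congr 1
            field_simp
        _ ≤ (m : ℝ) ^ (ε * ((La + Lb : ℕ) : ℝ) / 2) := by gcongr
        _ ≤ (m : ℝ) ^ (w.length : ℝ) := Real.rpow_le_rpow_of_exponent_le hm' (by linarith)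
        _ = (m : ℝ) ^ w.length := Real.rpow_natCast _ _
    · gcongr
      exact card_longSubwords_le ε La Lb d P
  · have h1 : (1 : ℝ) ≤ c ^ (La + Lb) := one_le_pow₀ hc.le
    have h2 := hf (La + Lb)
    gcongr
    rw [card_range]
    push_cast
    linarith

/-- One-symbol extensions of synchronization strings are synchronization strings or violators. -/
theorem extensions_subset (f : ℕ → ℕ) (ε : ℝ) (m n : ℕ) :
    (syncWords f ε m n ×ˢ univ).image (fun p => p.1 ++ [p.2]) ⊆
      syncWords f ε m (n + 1) ∪
        (Icc 1 n).biUnion fun La => (Icc 1 n).biUnion fun Lb => violators f ε m n La Lb := by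
  intro Q hQ
  obtain ⟨⟨S, x⟩, hS, rfl⟩ := mem_image.1 hQ
  obtain ⟨hlen, hsync⟩ := mem_syncWords.1 (mem_product.1 hS).1
  dsimp only at hlen hsync ⊢
  set Q := S ++ [x] with hQdef
  have hQlen : Q.length = n + 1 := by simp [hQdef, hlen]
  by_cases hgood : FDistSync f ε Q
  · exact mem_union_left _ (mem_syncWords.2 ⟨hQlen, hgood⟩)
  refine mem_union_right _ ?_
  unfold FDistSync at hgood
  push Not at hgood
  obtain ⟨i, j, i', j', hi, hij, hji, hij', hj', hd, hED⟩ := hgood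
  obtain rfl : j' = n + 2 := by
    by_contra hne
    have hj'' : j' ≤ S.length + 1 := by omega
    rw [hQdef, substr_append_left hi hij.le (by omega),
      substr_append_left (by omega) hij'.le hj''] at hED
    exact absurd (hsync i j i' j' hi hij hji hij' hj'' hd) (not_lt.2 hED)
  have hla := length_substr (S := Q) (j := j) hi (by omega)
  have hlb := length_substr (S := Q) (i := i') (j := n + 2) (by omega) hj'
  rw [← hla, ← hlb] at hED
  obtain ⟨w, hwa, hwb, hw⟩ := exists_common_sublist_of_ED_le hED
  rw [hla, hlb] at hw
  have hTlen : (Q.drop (i' - 1)).length = n + 2 - i' := by simp [hQlen]; omega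
  have hPlen : (Q.take (i' - 1)).length = i' - 1 := by simp [hQlen]; omega
  have hPQ : Q.take (i' - 1) ++ Q.drop (i' - 1) = Q := List.take_append_drop _ _
  have hwin : substr Q i' (n + 2) = Q.drop (i' - 1) := by
    rw [substr, List.take_of_length_le hTlen.le]
  simp only [violators, longSubwords, mem_biUnion, mem_Icc, mem_range, mem_image, mem_filter,
    mem_words, mem_syncWords, List.mem_toFinset, List.mem_sublists]
  refine ⟨j - i, ⟨by omega, by omega⟩, n + 2 - i', ⟨by omega, by omega⟩, i' - j, by omega,
    Q.take (i' - 1), ⟨by omega, ?_⟩, w, ⟨?_, hw⟩, Q.drop (i' - 1), ⟨hTlen, hwin ▸ hwb⟩, hPQ⟩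
  · have hP : Q.take (i' - 1) = S.take (i' - 1) :=
      List.take_append_of_le_length (by omega)
    rw [hP]
    rw [← List.take_append_drop (i' - 1) S] at hsync
    exact hsync.of_append
  · rw [hPlen, show i' - 1 + 1 - (i' - j) = j by omega, show j - (j - i) = i by omega,
      ← substr_append_left (T := Q.drop (i' - 1)) hi hij.le (by omega), hPQ]
    exact hwa

theorem sum_Icc_quarter_pow_le (n : ℕ) : ∑ k ∈ Icc 1 n, (1 / 4 : ℝ) ^ k ≤ 1 / 3 := by
  have h : ∑ k ∈ Icc 1 n, (1 / 4 : ℝ) ^ k = 1 / 3 - (1 / 4) ^ n / 3 := by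
    induction n with
    | zero => simp
    | succ n ih => rw [sum_Icc_succ_top (by omega), ih]; ring
  rw [h]
  have : (0 : ℝ) ≤ (1 / 4) ^ n / 3 := by positivity
  linarith

/-- The number of synchronization strings grows by a factor at least `m / 2` with each symbol. -/
theorem card_syncWords_growth {f : ℕ → ℕ} {ε c : ℝ} {m : ℕ} (hm : 1 ≤ m) (hc : 1 < c)
    (hf : ∀ l, (f l : ℝ) ≤ c ^ l) (hmM : (16 * c) ^ (2 / ε) ≤ m) (hε : 0 < ε) (n : ℕ) :
    (m / 2 : ℝ) * #(syncWords f ε m n) ≤ #(syncWords f ε m (n + 1)) := by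
  have hm' : (1 : ℝ) ≤ m := by exact_mod_cast hm
  have hc0 : 0 < c := by linarith
  induction n using Nat.strong_induction_on with
  | _ n ih =>
  have hpow : ∀ k ≤ n, (m / 2 : ℝ) ^ k * #(syncWords f ε m (n - k)) ≤ #(syncWords f ε m n) := by
    intro k
    induction k with
    | zero => simp
    | succ k ihk =>
      intro hk
      refine le_trans ?_ (ihk (by omega))
      have := ih (n - (k + 1)) (by omega)
      rw [show n - (k + 1) + 1 = n - k by omega] at this
      rw [pow_succ, mul_assoc]
      gcongr
  set G : ℝ := (#(syncWords f ε m n) : ℝ) with hG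
  have hterm : ∀ La ∈ Icc 1 n, ∀ Lb ∈ Icc 1 n, (#(violators f ε m n La Lb) : ℝ) ≤
      2 * m * G * ((1 / 4) ^ La * (1 / 4) ^ Lb) := by
    intro La _ Lb hLb
    obtain ⟨h1, h2⟩ := mem_Icc.1 hLb
    refine (card_violators_le hm hc (by positivity) hf hmM hε n La Lb).trans ?_
    have hP := hpow (Lb - 1) (by omega)
    rw [show n - (Lb - 1) = n + 1 - Lb by omega] at hP
    set g : ℝ := (#(syncWords f ε m (n + 1 - Lb)) : ℝ)
    have hP' : (m : ℝ) ^ Lb * g ≤ m * 2 ^ Lb * G := by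
      obtain ⟨b, rfl⟩ : ∃ b, Lb = b + 1 := ⟨Lb - 1, by omega⟩
      rw [Nat.add_sub_cancel, div_pow, div_mul_eq_mul_div, div_le_iff₀ (by positivity)] at hP
      calc (m : ℝ) ^ (b + 1) * g = m * (m ^ b * g) := by ring
        _ ≤ m * (G * 2 ^ b) := by gcongr
        _ ≤ m * (G * 2 ^ (b + 1)) := by gcongr <;> norm_num
        _ = _ := by ring
    have h16 : (16 : ℝ) ^ (La + Lb) = 4 ^ La * 4 ^ La * (4 ^ Lb * 4 ^ Lb) := by
      rw [pow_add, ← mul_pow, ← mul_pow]; norm_num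
    have h4 : (4 : ℝ) ^ Lb = 2 ^ Lb * 2 ^ Lb := by rw [← mul_pow]; norm_num
    calc 2 * c ^ (La + Lb) * (g * (2 ^ La * (2 ^ Lb * m ^ Lb / (16 * c) ^ (La + Lb))))
        = 2 * (2 ^ La * 2 ^ Lb / 16 ^ (La + Lb)) * (m ^ Lb * g) := by
          rw [mul_pow]; field_simp
      _ ≤ 2 * (4 ^ La * 2 ^ Lb / 16 ^ (La + Lb)) * (m * 2 ^ Lb * G) := by
          gcongr; norm_num
      _ = 2 * m * G * ((1 / 4) ^ La * (1 / 4) ^ Lb) := by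
          rw [h16, h4, div_pow, div_pow, one_pow, one_pow, h4]
          field_simp
  have hbad : (#((Icc 1 n).biUnion fun La => (Icc 1 n).biUnion fun Lb =>
      violators f ε m n La Lb) : ℝ) ≤ m / 2 * G := by
    calc _ ≤ ∑ La ∈ Icc 1 n, ∑ Lb ∈ Icc 1 n, (#(violators f ε m n La Lb) : ℝ) := by
          exact_mod_cast card_biUnion_le.trans (sum_le_sum fun _ _ => card_biUnion_le)
      _ ≤ ∑ La ∈ Icc 1 n, ∑ Lb ∈ Icc 1 n, 2 * m * G * ((1 / 4) ^ La * (1 / 4) ^ Lb) :=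
          sum_le_sum fun La hLa => sum_le_sum fun Lb hLb => hterm La hLa Lb hLb
      _ = 2 * m * G * ((∑ k ∈ Icc 1 n, (1 / 4 : ℝ) ^ k) * ∑ k ∈ Icc 1 n, (1 / 4 : ℝ) ^ k) := by
          simp_rw [← mul_sum, ← sum_mul]
      _ ≤ 2 * m * G * (1 / 3 * (1 / 3)) := by
          have := sum_Icc_quarter_pow_le n
          gcongr
      _ ≤ m / 2 * G := by
          have : 0 ≤ (m : ℝ) * G := by positivity
          linarith
  have hext := (card_le_card (extensions_subset f ε m n)).trans (card_union_le _ _)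
  rw [card_image_of_injective _ fun p q h => by
      have := List.append_inj' h rfl
      exact Prod.ext this.1 (by simpa using this.2),
    card_product, card_univ, Fintype.card_fin] at hext
  have hext' : G * m ≤ #(syncWords f ε m (n + 1)) + #((Icc 1 n).biUnion fun La =>
      (Icc 1 n).biUnion fun Lb => violators f ε m n La Lb) := by
    rw [hG]; exact_mod_cast hext
  linarith

theorem syncWords_nonempty {f : ℕ → ℕ} {ε c : ℝ} {m : ℕ} (hm : 1 ≤ m) (hc : 1 < c)
    (hf : ∀ l, (f l : ℝ) ≤ c ^ l) (hmM : (16 * c) ^ (2 / ε) ≤ m) (hε : 0 < ε) (n : ℕ) :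
    (syncWords f ε m n).Nonempty := by
  have hm' : (1 : ℝ) ≤ m := by exact_mod_cast hm
  induction n with
  | zero =>
    refine ⟨[], mem_syncWords.2 ⟨rfl, ?_⟩⟩
    intro i j i' j' hi hij hji hij' hj'
    simp at hj'
    omega
  | succ n ih =>
    have h := card_syncWords_growth hm hc hf hmM hε n
    have : (0 : ℝ) < #(syncWords f ε m n) := by exact_mod_cast ih.card_pos
    have : (0 : ℝ) < #(syncWords f ε m (n + 1)) := lt_of_lt_of_le (by positivity) h
    exact card_pos.1 (by exact_mod_cast this)

/-- For every real `c > 1` there are constants `c₀ > 1` and `ε₀ > 0` such that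
for every `ε ∈ (0, ε₀)` and every `n`, an `⌊c^l⌋`-distance `ε`-synchronization
string of length `n` exists over an alphabet of size at most `c₀^(1/ε)`. -/
theorem stmt_14 (c : ℝ) (hc : 1 < c) :
    ∃ c₀ ε₀ : ℝ, 1 < c₀ ∧ 0 < ε₀ ∧ ∀ ε : ℝ, 0 < ε → ε < ε₀ → ∀ n : ℕ, 0 < n →
      ∃ (m : ℕ) (S : List (Fin m)),
        (m : ℝ) ≤ c₀ ^ (1 / ε) ∧ S.length = n ∧
        FDistSync (fun l => ⌊c ^ l⌋₊) ε S := by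
  refine ⟨2 * (16 * c) ^ 2, 1, by nlinarith, one_pos, fun ε hε hε1 n _ => ?_⟩
  have hX : 1 ≤ (16 * c) ^ (2 / ε) := Real.one_le_rpow (by linarith) (by positivity)
  have hmM := Nat.le_ceil ((16 * c) ^ (2 / ε))
  have hm : 1 ≤ ⌈(16 * c) ^ (2 / ε)⌉₊ := Nat.one_le_ceil_iff.2 (by linarith)
  obtain ⟨S, hS⟩ := syncWords_nonempty (f := fun l => ⌊c ^ l⌋₊) hm hc
    (fun l => Nat.floor_le (by positivity)) hmM hε n
  obtain ⟨hlen, hsync⟩ := mem_syncWords.1 hS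
  refine ⟨_, S, ?_, hlen, hsync⟩
  have h2 : (2 : ℝ) ≤ 2 ^ (1 / ε) :=
    Real.self_le_rpow_of_one_le (by norm_num) ((one_le_div hε).2 hε1.le)
  calc (⌈(16 * c) ^ (2 / ε)⌉₊ : ℝ) ≤ (16 * c) ^ (2 / ε) + 1 :=
        (Nat.ceil_lt_add_one (by linarith)).le
    _ ≤ 2 * (16 * c) ^ (2 / ε) := by linarith
    _ ≤ 2 ^ (1 / ε) * (16 * c) ^ (2 / ε) := by gcongr
    _ = (2 * (16 * c) ^ 2) ^ (1 / ε) := by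
        rw [Real.mul_rpow (x := 2) (by norm_num) (by positivity), ← Real.rpow_natCast (16 * c) 2,
          ← Real.rpow_mul (by positivity), Nat.cast_ofNat, mul_one_div]
end
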